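/- arXiv:2102.10360 — 2 statements merged into one kernel-verified Lean document; each statement's English description precedes it below -/
import Mathlib

section
/- Let u be a smooth positive function on the closed unit ball of ℝ³ satisfying Δ²u(x) + (15/16)·u(x)^{−7} ≤ 0 for all x in the open unit ball B₁, and on the unit sphere ∂B₁ satisfying u = 1, ∂_ν u = 1/2, and Δu ≥ 5/4. Then u(x) = √((1+|x|²)/2) for all x in the closed unit ball. -/
open Metric Real

/-- The Euclidean Laplacian of a function on `ℝⁿ`, as the sum of pure second
derivatives in the coordinate directions. -/
noncomputable def laplacian {n : ℕ} (u : EuclideanSpace ℝ (Fin n) → ℝ)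
    (x : EuclideanSpace ℝ (Fin n)) : ℝ :=
  ∑ i : Fin n, iteratedFDeriv ℝ 2 u x ![EuclideanSpace.single i 1, EuclideanSpace.single i 1]

open MeasureTheory

/-- The partial derivative of `f` in the `i`-th coordinate direction. -/
noncomputable def partialDeriv {n : ℕ} (i : Fin n) (f : EuclideanSpace ℝ (Fin n) → ℝ)
    (x : EuclideanSpace ℝ (Fin n)) : ℝ :=
  fderiv ℝ f x (EuclideanSpace.single i 1)

theorem ContDiff.partialDeriv {n : ℕ} {m k : WithTop ℕ∞} {f : EuclideanSpace ℝ (Fin n) → ℝ}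
    (hf : ContDiff ℝ k f) (hk : m + 1 ≤ k) (i : Fin n) : ContDiff ℝ m (partialDeriv i f) :=
  (hf.fderiv_right hk).clm_apply contDiff_const

theorem laplacian_eq_sum_partialDeriv {n : ℕ} {f : EuclideanSpace ℝ (Fin n) → ℝ}
    (hf : ContDiff ℝ 2 f) (x : EuclideanSpace ℝ (Fin n)) :
    laplacian f x = ∑ i, partialDeriv i (partialDeriv i f) x := by
  refine Finset.sum_congr rfl fun i _ => ?_
  have hd : DifferentiableAt ℝ (fderiv ℝ f) x :=
    (hf.fderiv_right (m := 1) (by norm_num)).differentiable (by norm_num) x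
  rw [iteratedFDeriv_two_apply]
  unfold partialDeriv
  rw [fderiv_clm_apply hd (differentiableAt_const _)]
  simp

theorem ContDiff.laplacian {n : ℕ} {f : EuclideanSpace ℝ (Fin n) → ℝ}
    (hf : ContDiff ℝ (⊤ : ℕ∞) f) : ContDiff ℝ (⊤ : ℕ∞) (laplacian f) := by
  rw [funext fun x => laplacian_eq_sum_partialDeriv (contDiff_infty.1 hf 2) x]
  exact ContDiff.sum fun i _ =>
    (hf.partialDeriv (m := ((⊤ : ℕ∞) : WithTop ℕ∞)) (by norm_num) i).partialDeriv (by norm_num) i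

theorem fderiv_apply_eq_sum_partialDeriv {n : ℕ} (f : EuclideanSpace ℝ (Fin n) → ℝ)
    (x v : EuclideanSpace ℝ (Fin n)) :
    fderiv ℝ f x v = ∑ i, v i * partialDeriv i f x := by
  conv_lhs => rw [← (EuclideanSpace.basisFun (Fin n) ℝ).sum_repr v]
  simp [partialDeriv]

section Linearity

variable {n : ℕ} {f g : EuclideanSpace ℝ (Fin n) → ℝ}

theorem partialDeriv_add {x : EuclideanSpace ℝ (Fin n)} (i : Fin n)
    (hf : DifferentiableAt ℝ f x) (hg : DifferentiableAt ℝ g x) :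
    partialDeriv i (fun y => f y + g y) x = partialDeriv i f x + partialDeriv i g x := by
  simp [partialDeriv, fderiv_fun_add hf hg]

theorem partialDeriv_sub {x : EuclideanSpace ℝ (Fin n)} (i : Fin n)
    (hf : DifferentiableAt ℝ f x) (hg : DifferentiableAt ℝ g x) :
    partialDeriv i (fun y => f y - g y) x = partialDeriv i f x - partialDeriv i g x := by
  simp [partialDeriv, fderiv_fun_sub hf hg]

theorem partialDeriv_const_mul {x : EuclideanSpace ℝ (Fin n)} (i : Fin n) (c : ℝ)
    (hf : DifferentiableAt ℝ f x) :
    partialDeriv i (fun y => c * f y) x = c * partialDeriv i f x := by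
  simp [partialDeriv, fderiv_const_mul hf]

theorem partialDeriv_mul {x : EuclideanSpace ℝ (Fin n)} (i : Fin n)
    (hf : DifferentiableAt ℝ f x) (hg : DifferentiableAt ℝ g x) :
    partialDeriv i (fun y => f y * g y) x
      = f x * partialDeriv i g x + g x * partialDeriv i f x := by
  simp [partialDeriv, fderiv_fun_mul hf hg]

theorem laplacian_add (hf : ContDiff ℝ 2 f) (hg : ContDiff ℝ 2 g) (x : EuclideanSpace ℝ (Fin n)) :
    laplacian (fun y => f y + g y) x = laplacian f x + laplacian g x := by
  have hf' := fun i => (hf.partialDeriv (m := 1) (by norm_num) i).differentiable (by norm_num)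
  have hg' := fun i => (hg.partialDeriv (m := 1) (by norm_num) i).differentiable (by norm_num)
  have h : ∀ i, partialDeriv i (fun y => f y + g y)
      = fun y => partialDeriv i f y + partialDeriv i g y := fun i => funext fun y =>
    partialDeriv_add i (hf.differentiable (by norm_num) y) (hg.differentiable (by norm_num) y)
  rw [laplacian_eq_sum_partialDeriv (hf.add hg), laplacian_eq_sum_partialDeriv hf,
    laplacian_eq_sum_partialDeriv hg, ← Finset.sum_add_distrib]
  refine Finset.sum_congr rfl fun i _ => ?_
  rw [h, partialDeriv_add i (hf' i x) (hg' i x)]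

theorem laplacian_const_mul (hf : ContDiff ℝ 2 f) (c : ℝ) (x : EuclideanSpace ℝ (Fin n)) :
    laplacian (fun y => c * f y) x = c * laplacian f x := by
  have hf' := fun i => (hf.partialDeriv (m := 1) (by norm_num) i).differentiable (by norm_num)
  have h : ∀ i, partialDeriv i (fun y => c * f y) = fun y => c * partialDeriv i f y :=
    fun i => funext fun y => partialDeriv_const_mul i c (hf.differentiable (by norm_num) y)
  rw [laplacian_eq_sum_partialDeriv (contDiff_const.mul hf), laplacian_eq_sum_partialDeriv hf,
    Finset.mul_sum]
  refine Finset.sum_congr rfl fun i _ => ?_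
  rw [h, partialDeriv_const_mul i c (hf' i x)]

theorem laplacian_add_const_mul (hf : ContDiff ℝ 2 f) (hg : ContDiff ℝ 2 g) (c : ℝ) :
    laplacian (fun y => f y + c * g y) = fun x => laplacian f x + c * laplacian g x := by
  funext x
  rw [laplacian_add hf (contDiff_const.mul hg), laplacian_const_mul hg]

theorem bilaplacian_add_const_mul (hf : ContDiff ℝ (⊤ : ℕ∞) f) (hg : ContDiff ℝ (⊤ : ℕ∞) g)
    (c : ℝ) :
    laplacian (laplacian fun y => f y + c * g y)
      = fun x => laplacian (laplacian f) x + c * laplacian (laplacian g) x := by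
  rw [laplacian_add_const_mul (contDiff_infty.1 hf 2) (contDiff_infty.1 hg 2),
    laplacian_add_const_mul (contDiff_infty.1 hf.laplacian 2) (contDiff_infty.1 hg.laplacian 2)]

end Linearity

/-- A radial cutoff supported in the closed unit ball, converging to the indicator of the open
unit ball as `k → ∞`. -/
noncomputable def ballCutoff {n : ℕ} (k : ℝ) (x : EuclideanSpace ℝ (Fin n)) : ℝ :=
  smoothTransition (k * (1 - ‖x‖ ^ 2))

section Cutoff

variable {n : ℕ} {k : ℝ}

theorem contDiff_ballCutoff : ContDiff ℝ 1 (ballCutoff (n := n) k) :=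
  (smoothTransition.contDiff (n := 1)).comp
    (contDiff_const.mul (contDiff_const.sub (contDiff_norm_sq ℝ)))

theorem ballCutoff_eq_zero (hk : 0 < k) {x : EuclideanSpace ℝ (Fin n)} (hx : 1 ≤ ‖x‖) :
    ballCutoff k x = 0 :=
  smoothTransition.zero_of_nonpos (mul_nonpos_of_nonneg_of_nonpos hk.le (by nlinarith))

theorem hasCompactSupport_ballCutoff (hk : 0 < k) : HasCompactSupport (ballCutoff (n := n) k) :=
  HasCompactSupport.intro (isCompact_closedBall 0 1) fun x hx =>
    ballCutoff_eq_zero hk (by simpa using (lt_of_not_ge fun h => hx (by simpa using h)).le)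

theorem partialDeriv_ballCutoff (i : Fin n) (x : EuclideanSpace ℝ (Fin n)) :
    partialDeriv i (ballCutoff k) x
      = -(2 * k * deriv smoothTransition (k * (1 - ‖x‖ ^ 2)) * x i) := by
  have h1 : HasFDerivAt (fun y : EuclideanSpace ℝ (Fin n) => k * (1 - ‖y‖ ^ 2))
      (k • (-(2 • innerSL ℝ x) : EuclideanSpace ℝ (Fin n) →L[ℝ] ℝ)) x :=
    ((hasStrictFDerivAt_norm_sq x).hasFDerivAt.const_sub 1).const_mul k
  have h2 := ((smoothTransition.contDiff (n := 1)).differentiable (by norm_num)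
    (k * (1 - ‖x‖ ^ 2))).hasDerivAt.comp_hasFDerivAt x h1
  have h3 : HasFDerivAt (ballCutoff k) _ x := h2
  rw [partialDeriv, h3.fderiv]
  simp [EuclideanSpace.inner_single_right]
  ring

theorem deriv_smoothTransition_nonneg (t : ℝ) : 0 ≤ deriv smoothTransition t :=
  smoothTransition.monotone.deriv_nonneg

theorem deriv_smoothTransition_eq_zero {t : ℝ} (ht : t < 0 ∨ 1 < t) :
    deriv smoothTransition t = 0 := by
  rcases ht with ht | ht
  · have : smoothTransition =ᶠ[nhds t] fun _ => 0 := by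
      filter_upwards [gt_mem_nhds ht] with s hs using smoothTransition.zero_of_nonpos hs.le
    simp [this.deriv_eq]
  · have : smoothTransition =ᶠ[nhds t] fun _ => 1 := by
      filter_upwards [lt_mem_nhds ht] with s hs using smoothTransition.one_of_one_le hs.le
    simp [this.deriv_eq]

theorem integral_ballCutoff_mul_divergence (hk : 0 < k)
    {V : Fin n → EuclideanSpace ℝ (Fin n) → ℝ} (hV : ∀ i, ContDiff ℝ 1 (V i)) :
    ∫ x, ballCutoff k x * ∑ i, partialDeriv i (V i) x
      = ∫ x, 2 * k * deriv smoothTransition (k * (1 - ‖x‖ ^ 2)) * ∑ i, x i * V i x := by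
  have hη := contDiff_ballCutoff (n := n) (k := k)
  have hc := hasCompactSupport_ballCutoff (n := n) hk
  have hηd : ∀ i, Continuous (partialDeriv i (ballCutoff (n := n) k)) := fun i =>
    (hη.partialDeriv (m := 0) (by norm_num) i).continuous
  have hcd : ∀ i, HasCompactSupport (partialDeriv i (ballCutoff (n := n) k)) := fun i =>
    hc.fderiv_apply ℝ _
  have hVd : ∀ i, Continuous (partialDeriv i (V i)) := fun i =>
    ((hV i).partialDeriv (m := 0) (by norm_num) i).continuous
  have h1 : ∀ i, Integrable fun x => ballCutoff k x * partialDeriv i (V i) x := fun i =>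
    (hη.continuous.mul (hVd i)).integrable_of_hasCompactSupport hc.mul_right
  have h2 : ∀ i, Integrable fun x => partialDeriv i (ballCutoff k) x * V i x := fun i =>
    ((hηd i).mul (hV i).continuous).integrable_of_hasCompactSupport (hcd i).mul_right
  have h3 : ∀ i, ∫ x, ballCutoff k x * partialDeriv i (V i) x
      = -∫ x, partialDeriv i (ballCutoff k) x * V i x := fun i =>
    integral_mul_fderiv_eq_neg_fderiv_mul_of_integrable (h2 i) (h1 i)
      ((hη.continuous.mul (hV i).continuous).integrable_of_hasCompactSupport hc.mul_right)
      (fun x _ => hη.differentiable (by norm_num) x)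
      (fun x _ => (hV i).differentiable (by norm_num) x)
  simp only [Finset.mul_sum]
  rw [integral_finsetSum _ fun i _ => h1 i, integral_finsetSum]
  · refine Finset.sum_congr rfl fun i _ => ?_
    rw [h3 i, ← integral_neg]
    refine integral_congr_ae (.of_forall fun x => ?_)
    simp only [partialDeriv_ballCutoff]
    ring
  · intro i _
    convert! (h2 i).neg using 2 with x
    simp only [partialDeriv_ballCutoff, Pi.neg_apply]
    ring

theorem exists_integral_ballCutoff_mul_divergence_nonneg
    {V : Fin n → EuclideanSpace ℝ (Fin n) → ℝ} (hV : ∀ i, ContDiff ℝ 1 (V i))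
    (hb : ∀ x ∈ sphere (0 : EuclideanSpace ℝ (Fin n)) 1, 0 < ∑ i, x i * V i x) :
    ∃ k : ℝ, 1 ≤ k ∧ 0 ≤ ∫ x, ballCutoff k x * ∑ i, partialDeriv i (V i) x := by
  have hF : Continuous fun x : EuclideanSpace ℝ (Fin n) => ∑ i, x i * V i x :=
    continuous_finsetSum _ fun i _ => (EuclideanSpace.proj i).continuous.mul (hV i).continuous
  obtain ⟨m, hm0, hm1, hm⟩ : ∃ m : ℝ, 0 ≤ m ∧ m < 1 ∧
      ∀ x : EuclideanSpace ℝ (Fin n), ‖x‖ ≤ 1 → ∑ i, x i * V i x ≤ 0 → ‖x‖ ≤ m := by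
    have hK : IsCompact (closedBall (0 : EuclideanSpace ℝ (Fin n)) 1 ∩
        {x | ∑ i, x i * V i x ≤ 0}) :=
      (isCompact_closedBall 0 1).inter_right (isClosed_le hF continuous_const)
    rcases (closedBall (0 : EuclideanSpace ℝ (Fin n)) 1 ∩
        {x | ∑ i, x i * V i x ≤ 0}).eq_empty_or_nonempty with he | hne
    · refine ⟨0, le_rfl, one_pos, fun x hx hx' => ?_⟩
      exact (Set.eq_empty_iff_forall_notMem.1 he x ⟨by simpa using hx, hx'⟩).elim
    · obtain ⟨y, ⟨hy1, hy2⟩, hy⟩ := hK.exists_isMaxOn hne continuous_norm.continuousOn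
      refine ⟨‖y‖, norm_nonneg y, lt_of_le_of_ne (by simpa using hy1) fun h => ?_,
        fun x hx hx' => hy ⟨by simpa using hx, hx'⟩⟩
      exact (hb y (by simpa using h)).not_ge hy2
  have hpos : 0 < 1 - m ^ 2 := by nlinarith
  have hk : 1 ≤ 2 / (1 - m ^ 2) := by rw [le_div_iff₀ hpos]; nlinarith
  refine ⟨2 / (1 - m ^ 2), hk, ?_⟩
  rw [integral_ballCutoff_mul_divergence (by linarith) hV]
  refine integral_nonneg fun x => ?_
  have hcoef : 0 ≤ 2 * (2 / (1 - m ^ 2)) *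
      deriv smoothTransition (2 / (1 - m ^ 2) * (1 - ‖x‖ ^ 2)) :=
    mul_nonneg (by linarith) (deriv_smoothTransition_nonneg _)
  rcases lt_or_ge 1 ‖x‖ with hx | hx
  · have : 2 / (1 - m ^ 2) * (1 - ‖x‖ ^ 2) < 0 :=
      mul_neg_of_pos_of_neg (by linarith) (by nlinarith)
    simp [deriv_smoothTransition_eq_zero (.inl this)]
  rcases lt_or_ge 0 (∑ i, x i * V i x) with hs | hs
  · exact mul_nonneg hcoef hs.le
  · have hle := hm x hx hs
    have : 1 < 2 / (1 - m ^ 2) * (1 - ‖x‖ ^ 2) := by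
      rw [div_mul_eq_mul_div, lt_div_iff₀ hpos]
      nlinarith [norm_nonneg x]
    simp [deriv_smoothTransition_eq_zero (.inr this)]

theorem ballCutoff_mono {l : ℝ} (hk : 0 < k) (hkl : k ≤ l) {x : EuclideanSpace ℝ (Fin n)} :
    ballCutoff k x ≤ ballCutoff l x := by
  rcases lt_or_ge 1 ‖x‖ with hx | hx
  · rw [ballCutoff_eq_zero hk hx.le, ballCutoff_eq_zero (hk.trans_le hkl) hx.le]
  · exact smoothTransition.monotone
      (mul_le_mul_of_nonneg_right hkl (by nlinarith [norm_nonneg x]))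

theorem integral_ballCutoff_le (hk : 0 < k) :
    ∫ x, ballCutoff (n := n) k x ≤ volume.real (closedBall (0 : EuclideanSpace ℝ (Fin n)) 1) := by
  rw [← integral_indicator_one measurableSet_closedBall]
  refine integral_mono (contDiff_ballCutoff.continuous.integrable_of_hasCompactSupport
    (hasCompactSupport_ballCutoff hk)) ?_ fun x => ?_
  · exact (integrable_indicator_iff measurableSet_closedBall).2
      (integrableOn_const (isCompact_closedBall _ _).measure_lt_top.ne)
  · by_cases hx : x ∈ closedBall (0 : EuclideanSpace ℝ (Fin n)) 1
    · rw [Set.indicator_of_mem hx]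
      exact smoothTransition.le_one _
    · rw [Set.indicator_of_notMem hx, ballCutoff_eq_zero hk]
      simpa using (lt_of_not_ge fun h => hx (by simpa using h)).le

theorem partialDeriv_const_mul_coord (i : Fin n) (c : ℝ) (x : EuclideanSpace ℝ (Fin n)) :
    partialDeriv i (fun y => c * y i) x = c := by
  have h : HasFDerivAt (fun y : EuclideanSpace ℝ (Fin n) => c * y i)
      (c • (EuclideanSpace.proj i : EuclideanSpace ℝ (Fin n) →L[ℝ] ℝ)) x :=
    (EuclideanSpace.proj i : EuclideanSpace ℝ (Fin n) →L[ℝ] ℝ).hasFDerivAt.const_mul c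
  simp [partialDeriv, h.fderiv]

/-- A vector field on the unit ball that points weakly outward along the sphere and has nonpositive
divergence is divergence free. -/
theorem divergence_eq_zero_of_nonpos_of_outward
    {V : Fin n → EuclideanSpace ℝ (Fin n) → ℝ} (hV : ∀ i, ContDiff ℝ 1 (V i))
    (hb : ∀ x ∈ sphere (0 : EuclideanSpace ℝ (Fin n)) 1, 0 ≤ ∑ i, x i * V i x)
    (hd : ∀ x ∈ ball (0 : EuclideanSpace ℝ (Fin n)) 1, ∑ i, partialDeriv i (V i) x ≤ 0) :
    ∀ x ∈ ball (0 : EuclideanSpace ℝ (Fin n)) 1, ∑ i, partialDeriv i (V i) x = 0 := by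
  have hdiv : Continuous fun x => ∑ i, partialDeriv i (V i) x :=
    continuous_finsetSum _ fun i _ => ((hV i).partialDeriv (m := 0) (by norm_num) i).continuous
  have hcont : ∀ k : ℝ, Continuous fun x => ballCutoff k x * ∑ i, partialDeriv i (V i) x :=
    fun k => contDiff_ballCutoff.continuous.mul hdiv
  have hsupp : ∀ {k : ℝ}, 0 < k →
      HasCompactSupport fun x => ballCutoff k x * ∑ i, partialDeriv i (V i) x :=
    fun hk => (hasCompactSupport_ballCutoff hk).mul_right
  have hint : ∀ {k : ℝ}, 0 < k →
      Integrable fun x => ballCutoff k x * ∑ i, partialDeriv i (V i) x :=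
    fun hk => (hcont _).integrable_of_hasCompactSupport (hsupp hk)
  have hlower : ∀ δ : ℝ, 0 < δ →
      -(volume.real (closedBall (0 : EuclideanSpace ℝ (Fin n)) 1) * n * δ)
        ≤ ∫ x, ballCutoff 1 x * ∑ i, partialDeriv i (V i) x := by
    intro δ hδ
    have hcoord : ∀ i : Fin n, ContDiff ℝ 1 fun x : EuclideanSpace ℝ (Fin n) => δ * x i :=
      fun i => contDiff_const.mul (EuclideanSpace.proj (𝕜 := ℝ) i).contDiff
    obtain ⟨k, hk1, hk⟩ := exists_integral_ballCutoff_mul_divergence_nonneg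
      (V := fun i x => V i x + δ * x i) (fun i => (hV i).add (hcoord i)) (by
        intro x hx
        have hnorm : ∑ i, x i ^ 2 = 1 := by
          rw [← EuclideanSpace.real_norm_sq_eq, mem_sphere_zero_iff_norm.1 hx, one_pow]
        have : ∑ i, x i * (V i x + δ * x i) = ∑ i, x i * V i x + δ * ∑ i, x i ^ 2 := by
          rw [Finset.mul_sum, ← Finset.sum_add_distrib]
          exact Finset.sum_congr rfl fun i _ => by ring
        rw [this, hnorm]
        linarith [hb x hx])
    have hk0 : 0 < k := by linarith
    have hsplit : ∀ x, ballCutoff k x * ∑ i, partialDeriv i (fun y => V i y + δ * y i) x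
        = ballCutoff k x * ∑ i, partialDeriv i (V i) x + ballCutoff k x * (n * δ) := by
      intro x
      rw [← mul_add]
      congr 1
      rw [show (n : ℝ) * δ = ∑ _i : Fin n, δ by simp, ← Finset.sum_add_distrib]
      refine Finset.sum_congr rfl fun i _ => ?_
      rw [partialDeriv_add i ((hV i).differentiable (by norm_num) x)
        ((hcoord i).differentiable (by norm_num) x), partialDeriv_const_mul_coord]
    have hηint : Integrable (ballCutoff (n := n) k) :=
      contDiff_ballCutoff.continuous.integrable_of_hasCompactSupport
        (hasCompactSupport_ballCutoff hk0)
    simp only [hsplit] at hk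
    rw [integral_add (hint hk0) (hηint.mul_const _), integral_mul_const] at hk
    have hmono : ∫ x, ballCutoff k x * ∑ i, partialDeriv i (V i) x
        ≤ ∫ x, ballCutoff 1 x * ∑ i, partialDeriv i (V i) x := by
      refine integral_mono (hint hk0) (hint one_pos) fun x => ?_
      by_cases hx : x ∈ ball (0 : EuclideanSpace ℝ (Fin n)) 1
      · exact mul_le_mul_of_nonpos_right (ballCutoff_mono one_pos hk1) (hd x hx)
      · have hx' : 1 ≤ ‖x‖ := by simpa using hx
        simp [ballCutoff_eq_zero hk0 hx', ballCutoff_eq_zero one_pos hx']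
    have hvol := mul_le_mul_of_nonneg_right (integral_ballCutoff_le (n := n) hk0)
      (show 0 ≤ (n : ℝ) * δ by positivity)
    linarith
  have hnonneg : 0 ≤ ∫ x, ballCutoff 1 x * ∑ i, partialDeriv i (V i) x := by
    by_contra! hneg
    set I := ∫ x, ballCutoff 1 x * ∑ i, partialDeriv i (V i) x
    set C := volume.real (closedBall (0 : EuclideanSpace ℝ (Fin n)) 1) * n
    have hC : 0 ≤ C := by positivity
    have h := hlower (-I / (2 * (C + 1))) (div_pos (by linarith) (by linarith))
    have h2 : C * (-I / (2 * (C + 1))) ≤ -I / 2 := by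
      rw [mul_div_assoc', div_le_div_iff₀ (by linarith) two_pos]
      nlinarith
    linarith
  intro x hx
  by_contra hne
  have hxn : ‖x‖ < 1 := by simpa using hx
  have hηx : 0 < ballCutoff 1 x := smoothTransition.pos_of_pos (by nlinarith [norm_nonneg x])
  have hlt := (hcont 1).neg.integral_pos_of_hasCompactSupport_nonneg_nonzero (μ := volume)
    (x := x) (hsupp one_pos).neg (fun y => by
      by_cases hy : y ∈ ball (0 : EuclideanSpace ℝ (Fin n)) 1
      · exact neg_nonneg.2 (mul_nonpos_of_nonneg_of_nonpos (smoothTransition.nonneg _) (hd y hy))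
      · simp [ballCutoff_eq_zero one_pos (show 1 ≤ ‖y‖ by simpa using hy)])
    (neg_ne_zero.2 (mul_ne_zero hηx.ne' hne))
  rw [integral_neg'] at hlt
  linarith

end Cutoff

/-- Powers of the conformal factor of the stereographic projection. -/
noncomputable def stereoPow {n : ℕ} (a : ℝ) (x : EuclideanSpace ℝ (Fin n)) : ℝ :=
  ((1 + ‖x‖ ^ 2) / 2) ^ a

section StereoPow

variable {n : ℕ}

theorem stereoPow_base_pos (x : EuclideanSpace ℝ (Fin n)) : 0 < (1 + ‖x‖ ^ 2) / 2 := by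
  positivity

theorem contDiff_stereoPow {m : WithTop ℕ∞} (a : ℝ) : ContDiff ℝ m (stereoPow (n := n) a) :=
  ((contDiff_const.add (contDiff_norm_sq ℝ)).div_const 2).rpow_const_of_ne
    fun x => (stereoPow_base_pos x).ne'

theorem stereoPow_eq_one {x : EuclideanSpace ℝ (Fin n)} (hx : ‖x‖ = 1) (a : ℝ) :
    stereoPow a x = 1 := by
  simp [stereoPow, hx]

theorem partialDeriv_stereoPow (a : ℝ) (i : Fin n) (x : EuclideanSpace ℝ (Fin n)) :
    partialDeriv i (stereoPow a) x = a * x i * stereoPow (a - 1) x := by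
  have h1 : HasFDerivAt (fun y : EuclideanSpace ℝ (Fin n) => (1 + ‖y‖ ^ 2) * 2⁻¹)
      ((2⁻¹ : ℝ) • (2 • innerSL ℝ x : EuclideanSpace ℝ (Fin n) →L[ℝ] ℝ)) x :=
    ((hasStrictFDerivAt_norm_sq x).hasFDerivAt.const_add 1).mul_const 2⁻¹
  have h2 : HasFDerivAt (stereoPow a) _ x :=
    HasFDerivAt.rpow_const (p := a) h1 (.inl (stereoPow_base_pos x).ne')
  rw [partialDeriv, h2.fderiv]
  simp [EuclideanSpace.inner_single_right, stereoPow, div_eq_mul_inv]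
  ring

theorem laplacian_stereoPow (a : ℝ) (x : EuclideanSpace ℝ (Fin 3)) :
    laplacian (stereoPow a) x
      = a * (2 * a + 1) * stereoPow (a - 1) x + -(a * (a - 1)) * stereoPow (a - 2) x := by
  have hsq : ∑ i, x i ^ 2 = ‖x‖ ^ 2 := (EuclideanSpace.real_norm_sq_eq x).symm
  have hstep : stereoPow (a - 1) x = (1 + ‖x‖ ^ 2) / 2 * stereoPow (a - 2) x := by
    have := rpow_add_one (stereoPow_base_pos x).ne' (a - 2)
    rw [show a - 2 + 1 = a - 1 by ring] at this
    rw [stereoPow, this, stereoPow]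
    ring
  have hsum : ∀ i, partialDeriv i (partialDeriv i (stereoPow a)) x
      = a * stereoPow (a - 1) x + a * (a - 1) * stereoPow (a - 2) x * x i ^ 2 := by
    intro i
    rw [show partialDeriv i (stereoPow a) = fun y => a * y i * stereoPow (a - 1) y from
      funext fun y => partialDeriv_stereoPow a i y]
    rw [partialDeriv_mul i
      (f := fun y => a * y i) ((EuclideanSpace.proj (𝕜 := ℝ) i).differentiableAt.const_mul a)
      ((contDiff_stereoPow (m := 1) (a - 1)).differentiable (by norm_num) x),
      partialDeriv_const_mul_coord, partialDeriv_stereoPow,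
      show a - 1 - 1 = a - 2 by ring]
    ring
  rw [laplacian_eq_sum_partialDeriv (contDiff_stereoPow a)]
  simp only [hsum]
  rw [Finset.sum_add_distrib, ← Finset.mul_sum Finset.univ (fun i => x i ^ 2), hsq, hstep]
  simp
  ring

theorem bilaplacian_stereoPow (a : ℝ) (x : EuclideanSpace ℝ (Fin 3)) :
    laplacian (laplacian (stereoPow a)) x
      = a * (2 * a + 1) * ((a - 1) * (2 * a - 1)) * stereoPow (a - 2) x
        - 2 * a * (a - 1) * (a - 2) * (2 * a - 1) * stereoPow (a - 3) x
        + a * (a - 1) * (a - 2) * (a - 3) * stereoPow (a - 4) x := by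
  rw [show laplacian (stereoPow a) = fun x : EuclideanSpace ℝ (Fin 3) =>
      a * (2 * a + 1) * stereoPow (a - 1) x + -(a * (a - 1)) * stereoPow (a - 2) x from
      funext (laplacian_stereoPow a),
    laplacian_add_const_mul (contDiff_const.mul (contDiff_stereoPow _)) (contDiff_stereoPow _)]
  simp only [laplacian_const_mul (contDiff_stereoPow (a - 1)), laplacian_stereoPow]
  rw [show a - 1 - 1 = a - 2 by ring, show a - 1 - 2 = a - 3 by ring,
    show a - 2 - 1 = a - 3 by ring, show a - 2 - 2 = a - 4 by ring]
  ring

theorem stereoPow_neg_half (m : ℕ) (x : EuclideanSpace ℝ (Fin n)) :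
    stereoPow (-(m / 2 : ℝ)) x = (stereoPow (1 / 2) x ^ m)⁻¹ := by
  rw [stereoPow, stereoPow, rpow_neg (stereoPow_base_pos x).le, ← rpow_natCast _ m,
    ← rpow_mul (stereoPow_base_pos x).le]
  congr 2
  ring

theorem fderiv_stereoPow_self (a : ℝ) {x : EuclideanSpace ℝ (Fin n)} (hx : ‖x‖ = 1) :
    fderiv ℝ (stereoPow a) x x = a := by
  have hsq : ∑ i, x i ^ 2 = 1 := by rw [← EuclideanSpace.real_norm_sq_eq, hx, one_pow]
  rw [fderiv_apply_eq_sum_partialDeriv]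
  simp only [partialDeriv_stereoPow, stereoPow_eq_one hx]
  calc ∑ i, x i * (a * x i * 1) = a * ∑ i, x i ^ 2 := by
        rw [Finset.mul_sum]
        exact Finset.sum_congr rfl fun i _ => by ring
    _ = a := by rw [hsq, mul_one]

end StereoPow

section Green

variable {n : ℕ} {f g : EuclideanSpace ℝ (Fin n) → ℝ}

theorem contDiff_mul_partialDeriv_sub (hf : ContDiff ℝ 2 f) (hg : ContDiff ℝ 2 g) (i : Fin n) :
    ContDiff ℝ 1 fun x => f x * partialDeriv i g x - g x * partialDeriv i f x :=
  ((hf.of_le one_le_two).mul (hg.partialDeriv (by norm_num) i)).sub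
    ((hg.of_le one_le_two).mul (hf.partialDeriv (by norm_num) i))

theorem sum_partialDeriv_mul_partialDeriv_sub (hf : ContDiff ℝ 2 f) (hg : ContDiff ℝ 2 g)
    (x : EuclideanSpace ℝ (Fin n)) :
    ∑ i, partialDeriv i (fun y => f y * partialDeriv i g y - g y * partialDeriv i f y) x
      = f x * laplacian g x - g x * laplacian f x := by
  rw [laplacian_eq_sum_partialDeriv hf, laplacian_eq_sum_partialDeriv hg, Finset.mul_sum,
    Finset.mul_sum, ← Finset.sum_sub_distrib]
  refine Finset.sum_congr rfl fun i _ => ?_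
  have hf0 := hf.differentiable (by norm_num) x
  have hg0 := hg.differentiable (by norm_num) x
  have hf1 := (hf.partialDeriv (m := 1) (by norm_num) i).differentiable (by norm_num) x
  have hg1 := (hg.partialDeriv (m := 1) (by norm_num) i).differentiable (by norm_num) x
  rw [partialDeriv_sub i (hf0.fun_mul hg1) (hg0.fun_mul hf1), partialDeriv_mul i hf0 hg1, partialDeriv_mul i hg0 hf1]
  ring

end Green

/-- The function `t ↦ t⁻⁷` lies strictly above its tangent lines away from the base point. -/
theorem inv_pow_seven_sub_tangent_pos {a b : ℝ} (ha : 0 < a) (hb : 0 < b) (hab : a ≠ b) :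
    0 < (a ^ 7)⁻¹ - (b ^ 7)⁻¹ + 7 * (b ^ 8)⁻¹ * (a - b) := by
  have hfac : (a ^ 7)⁻¹ - (b ^ 7)⁻¹ + 7 * (b ^ 8)⁻¹ * (a - b) =
      (a - b) ^ 2 * ((7 * a ^ 6 + 6 * a ^ 5 * b + 5 * a ^ 4 * b ^ 2 + 4 * a ^ 3 * b ^ 3
        + 3 * a ^ 2 * b ^ 4 + 2 * a * b ^ 5 + b ^ 6) / (a ^ 7 * b ^ 8)) := by
    field_simp
    ring
  rw [hfac]
  have := sub_ne_zero.2 hab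
  positivity

/-- Hemisphere rigidity, analytic form, `n = 3` (Theorem A of the paper). -/
theorem stmt_2 (u : EuclideanSpace ℝ (Fin 3) → ℝ) (hu : ContDiff ℝ (⊤ : ℕ∞) u)
    (hpos : ∀ x ∈ closedBall (0 : EuclideanSpace ℝ (Fin 3)) 1, 0 < u x)
    (hineq : ∀ x ∈ ball (0 : EuclideanSpace ℝ (Fin 3)) 1,
      laplacian (laplacian u) x + (15 / 16) * u x ^ (-7 : ℝ) ≤ 0)
    (hbd : ∀ x ∈ sphere (0 : EuclideanSpace ℝ (Fin 3)) 1, u x = 1)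
    (hnu : ∀ x ∈ sphere (0 : EuclideanSpace ℝ (Fin 3)) 1, fderiv ℝ u x x = 1 / 2)
    (hlap : ∀ x ∈ sphere (0 : EuclideanSpace ℝ (Fin 3)) 1, laplacian u x ≥ 5 / 4) :
    ∀ x ∈ closedBall (0 : EuclideanSpace ℝ (Fin 3)) 1,
      u x = Real.sqrt ((1 + ‖x‖ ^ 2) / 2) := by
  set p : ℝ → EuclideanSpace ℝ (Fin 3) → ℝ := stereoPow with hp
  have hps : ∀ a, ContDiff ℝ (⊤ : ℕ∞) (p a) := fun a => contDiff_stereoPow a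
  have hp7 : ∀ x, p (-7 / 2) x = (p (1 / 2) x ^ 7)⁻¹ := fun x => by
    rw [← stereoPow_neg_half]; norm_num [hp]
  have hp9 : ∀ x, p (-9 / 2) x = (p (1 / 2) x ^ 9)⁻¹ := fun x => by
    rw [← stereoPow_neg_half]; norm_num [hp]
  have hp1 : ∀ x, p (-1 / 2) x = (p (1 / 2) x)⁻¹ := fun x => by
    rw [← pow_one (p (1 / 2) x), ← stereoPow_neg_half]; norm_num [hp]
  -- `w` is the deviation from the model; `φ`, the derivative of the model along dilations, lies in
  -- the kernel of the linearized equation.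
  set w : EuclideanSpace ℝ (Fin 3) → ℝ := fun x => u x + -1 * p (1 / 2) x with hw
  set φ : EuclideanSpace ℝ (Fin 3) → ℝ := fun x => p (-1 / 2) x + -1 * p (1 / 2) x with hφ
  have hws : ContDiff ℝ (⊤ : ℕ∞) w := hu.add (contDiff_const.mul (hps _))
  have hφs : ContDiff ℝ (⊤ : ℕ∞) φ := (hps _).add (contDiff_const.mul (hps _))
  have hw2 := contDiff_infty.1 hws 2
  have hφ2 := contDiff_infty.1 hφs 2
  have hlw2 := contDiff_infty.1 hws.laplacian 2
  have hlφ2 := contDiff_infty.1 hφs.laplacian 2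
  have hbw : ∀ x, laplacian (laplacian w) x
      = laplacian (laplacian u) x + 15 / 16 * p (-7 / 2) x := fun x => by
    rw [hw, bilaplacian_add_const_mul hu (hps _)]
    simp only [hp, bilaplacian_stereoPow]
    norm_num
  have hbφ : ∀ x, laplacian (laplacian φ) x
      = 105 / 16 * (p (-9 / 2) x - p (-7 / 2) x) := fun x => by
    rw [hφ, bilaplacian_add_const_mul (hps _) (hps _)]
    simp only [hp, bilaplacian_stereoPow]
    norm_num
    ring
  set V : Fin 3 → EuclideanSpace ℝ (Fin 3) → ℝ := fun i x =>
    (φ x * partialDeriv i (laplacian w) x - laplacian w x * partialDeriv i φ x)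
      + (laplacian φ x * partialDeriv i w x - w x * partialDeriv i (laplacian φ) x) with hVdef
  have hV1 := fun i => contDiff_mul_partialDeriv_sub hφ2 hlw2 i
  have hV2 := fun i => contDiff_mul_partialDeriv_sub hlφ2 hw2 i
  have hV : ∀ i, ContDiff ℝ 1 (V i) := fun i => (hV1 i).add (hV2 i)
  have hdiv : ∀ x, ∑ i, partialDeriv i (V i) x
      = φ x * laplacian (laplacian w) x - w x * laplacian (laplacian φ) x := by
    intro x
    have : ∀ i, partialDeriv i (V i) x = _ := fun i =>
      partialDeriv_add i ((hV1 i).differentiable (by norm_num) x)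
        ((hV2 i).differentiable (by norm_num) x)
    simp only [this, Finset.sum_add_distrib]
    rw [sum_partialDeriv_mul_partialDeriv_sub hφ2 hlw2,
      sum_partialDeriv_mul_partialDeriv_sub hlφ2 hw2]
    ring
  have hflux : ∀ x ∈ sphere (0 : EuclideanSpace ℝ (Fin 3)) 1, 0 ≤ ∑ i, x i * V i x := by
    intro x hx
    have hx1 : ‖x‖ = 1 := mem_sphere_zero_iff_norm.1 hx
    have hdp : ∀ a, DifferentiableAt ℝ (p a) x := fun a => (hps a).differentiable (by simp) x
    have hφ0 : φ x = 0 := by simp [hφ, hp, stereoPow_eq_one hx1]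
    have hw0 : w x = 0 := by simp [hw, hp, stereoPow_eq_one hx1, hbd x hx]
    have hdφ : fderiv ℝ φ x x = -1 := by
      rw [hφ, fderiv_fun_add (hdp _) ((hdp _).const_mul _), fderiv_const_mul (hdp _)]
      simp only [add_apply, smul_apply, hp,
        fderiv_stereoPow_self _ hx1]
      norm_num
    have hdw : fderiv ℝ w x x = 0 := by
      rw [hw, fderiv_fun_add (hu.differentiable (by simp) x) ((hdp _).const_mul _),
        fderiv_const_mul (hdp _)]
      simp only [add_apply, smul_apply, hp,
        fderiv_stereoPow_self _ hx1, hnu x hx]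
      norm_num
    have hlw : 0 ≤ laplacian w x := by
      rw [hw, laplacian_add_const_mul (contDiff_infty.1 hu 2) (contDiff_infty.1 (hps _) 2)]
      simp only [hp, laplacian_stereoPow, stereoPow_eq_one hx1]
      linarith [hlap x hx]
    have hsum : ∑ i, x i * V i x
        = φ x * fderiv ℝ (laplacian w) x x - laplacian w x * fderiv ℝ φ x x
          + (laplacian φ x * fderiv ℝ w x x - w x * fderiv ℝ (laplacian φ) x x) := by
      simp only [fderiv_apply_eq_sum_partialDeriv, Finset.mul_sum, ← Finset.sum_sub_distrib,
        ← Finset.sum_add_distrib]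
      exact Finset.sum_congr rfl fun i _ => by rw [hVdef]; ring
    rw [hsum, hφ0, hw0, hdφ, hdw]
    linarith
  have hb0 : ∀ x, 0 < p (1 / 2) x := fun x => rpow_pos_of_pos (stereoPow_base_pos x) _
  have hφpos : ∀ x ∈ ball (0 : EuclideanSpace ℝ (Fin 3)) 1, 0 < φ x := by
    intro x hx
    have hx1 : ‖x‖ < 1 := by simpa using hx
    have hlt : p (1 / 2) x < 1 :=
      rpow_lt_one (stereoPow_base_pos x).le (by nlinarith [norm_nonneg x]) (by norm_num)
    have := (one_lt_inv₀ (hb0 x)).2 hlt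
    simp only [hφ, hp1]
    linarith
  have hdle : ∀ x ∈ ball (0 : EuclideanSpace ℝ (Fin 3)) 1, ∑ i, partialDeriv i (V i) x
      ≤ -(15 / 16 * φ x * ((u x ^ 7)⁻¹ - (p (1 / 2) x ^ 7)⁻¹
        + 7 * (p (1 / 2) x ^ 8)⁻¹ * (u x - p (1 / 2) x))) := by
    intro x hx
    have hu0 := hpos x (ball_subset_closedBall hx)
    have hi := hineq x hx
    rw [show (-7 : ℝ) = -((7 : ℕ) : ℝ) by norm_num, rpow_neg hu0.le, rpow_natCast] at hi
    have hker : p (-9 / 2) x - p (-7 / 2) x = (p (1 / 2) x ^ 8)⁻¹ * φ x := by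
      have := (hb0 x).ne'
      simp only [hφ, hp1, hp7, hp9]
      field_simp
      ring
    rw [hdiv, hbw, hbφ, hker, hp7]
    simp only [hw]
    nlinarith [mul_le_mul_of_nonneg_left hi (hφpos x hx).le]
  have hzero := divergence_eq_zero_of_nonpos_of_outward hV hflux fun x hx => by
    refine (hdle x hx).trans (neg_nonpos.2 (mul_nonneg (by linarith [hφpos x hx]) ?_))
    rcases eq_or_ne (u x) (p (1 / 2) x) with h | h
    · simp [h]
    · exact (inv_pow_seven_sub_tangent_pos (hpos x (ball_subset_closedBall hx)) (hb0 x) h).le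
  intro x hx
  rw [sqrt_eq_rpow]
  rcases (mem_closedBall_zero_iff.1 hx).lt_or_eq with hx1 | hx1
  · have hxb : x ∈ ball (0 : EuclideanSpace ℝ (Fin 3)) 1 := mem_ball_zero_iff.2 hx1
    by_contra hne
    have h1 := hdle x hxb
    rw [hzero x hxb] at h1
    have h2 := mul_pos (mul_pos (by norm_num : (0 : ℝ) < 15 / 16) (hφpos x hxb))
      (inv_pow_seven_sub_tangent_pos (hpos x hx) (hb0 x) hne)
    linarith
  · rw [hbd x (mem_sphere_zero_iff_norm.2 hx1), hx1]
    norm_num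
end

section
/- Let v : [0,∞) → ℝ be a smooth function satisfying v''''(t) − 4v''(t) = 6e^{4v(t)} for all t ≥ 0, with v(0) = 0, v'(0) = 0, and such that v'(t) → −1, v''(t) → 0, and v'''(t) → 0 as t → ∞. Then v''(0) = 1 or v''(0) = −1. -/
open Real Filter

/-- A differentiable function whose derivative has a negative limit at `+∞` tends to `-∞`. -/
theorem tendsto_atBot_of_tendsto_deriv_neg {f : ℝ → ℝ} {c : ℝ} (hf : Differentiable ℝ f)
    (hc : c < 0) (h : Tendsto (deriv f) atTop (nhds c)) : Tendsto f atTop atBot := by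
  obtain ⟨T, hT⟩ := eventually_atTop.1 (h.eventually_le_const (show c < c / 2 by linarith))
  have hlin : Tendsto (fun t : ℝ => c / 2 * (t - T) + f T) atTop atBot :=
    tendsto_atBot_add_const_right _ _
      ((tendsto_atTop_add_const_right atTop (-T) tendsto_id).const_mul_atTop_of_neg
        (by linarith))
  refine tendsto_atBot_mono' atTop ?_ hlin
  filter_upwards [eventually_ge_atTop T] with t ht
  have hmvt := (convex_Ici T).image_sub_le_mul_sub_of_deriv_le hf.continuous.continuousOn
    hf.differentiableOn (fun x hx => hT x (interior_subset hx)) T Set.self_mem_Ici t ht ht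
  linarith

/-- The first integral of the equation `v'''' - 4v'' = 6e^{4v}`. -/
noncomputable def firstIntegral (v : ℝ → ℝ) (t : ℝ) : ℝ :=
  deriv^[3] v t * deriv v t - 1 / 2 * deriv^[2] v t ^ 2 - 2 * deriv v t ^ 2
    - 3 / 2 * exp (4 * v t)

theorem ContDiff.hasDerivAt_iterate_deriv {v : ℝ → ℝ} (hv : ContDiff ℝ (⊤ : ℕ∞) v) (n : ℕ)
    (t : ℝ) : HasDerivAt (deriv^[n] v) (deriv^[n + 1] v t) t := by
  rw [Function.iterate_succ_apply']
  exact ((hv.iterate_deriv n).differentiable (by simp) t).hasDerivAt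

theorem hasDerivAt_firstIntegral {v : ℝ → ℝ} (hv : ContDiff ℝ (⊤ : ℕ∞) v) (t : ℝ) :
    HasDerivAt (firstIntegral v)
      (deriv v t * (deriv^[4] v t - 4 * deriv^[2] v t - 6 * exp (4 * v t))) t := by
  have d0 : HasDerivAt v (deriv v t) t := hv.hasDerivAt_iterate_deriv 0 t
  have d1 : HasDerivAt (deriv v) (deriv^[2] v t) t := hv.hasDerivAt_iterate_deriv 1 t
  have d2 := hv.hasDerivAt_iterate_deriv 2 t
  have d3 := hv.hasDerivAt_iterate_deriv 3 t
  refine ((((d3.mul d1).sub ((d2.pow 2).const_mul (1 / 2))).sub ((d1.pow 2).const_mul 2)).sub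
    ((d0.const_mul 4).exp.const_mul (3 / 2))).congr_deriv ?_
  norm_num
  ring

/-- Along solutions on `[0, ∞)` the first integral keeps its initial value. -/
theorem firstIntegral_eq_initial {v : ℝ → ℝ} (hv : ContDiff ℝ (⊤ : ℕ∞) v)
    (heq : ∀ t ≥ (0 : ℝ), deriv^[4] v t - 4 * deriv^[2] v t = 6 * exp (4 * v t))
    {t : ℝ} (ht : 0 ≤ t) : firstIntegral v t = firstIntegral v 0 := by
  refine constant_of_has_deriv_right_zero (a := 0) (b := t)
    (fun x _ => (hasDerivAt_firstIntegral hv x).continuousAt.continuousWithinAt)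
    (fun x hx => ?_) t ⟨ht, le_rfl⟩
  refine ((hasDerivAt_firstIntegral hv x).congr_deriv ?_).hasDerivWithinAt
  rw [heq x hx.1, sub_self, mul_zero]

theorem tendsto_firstIntegral {v : ℝ → ℝ} (hv : Differentiable ℝ v)
    (hlim1 : Tendsto (deriv v) atTop (nhds (-1)))
    (hlim2 : Tendsto (deriv^[2] v) atTop (nhds 0))
    (hlim3 : Tendsto (deriv^[3] v) atTop (nhds 0)) :
    Tendsto (firstIntegral v) atTop (nhds (-2)) := by
  have hexp : Tendsto (fun t => exp (4 * v t)) atTop (nhds 0) :=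
    tendsto_exp_atBot.comp ((tendsto_atBot_of_tendsto_deriv_neg hv (by norm_num)
      hlim1).const_mul_atBot (by norm_num))
  have h := (((hlim3.mul hlim1).sub ((hlim2.pow 2).const_mul (1 / 2))).sub
    ((hlim1.pow 2).const_mul 2)).sub (hexp.const_mul (3 / 2))
  rwa [show (0 * -1 - 1 / 2 * 0 ^ 2 - 2 * (-1) ^ 2 - 3 / 2 * 0 : ℝ) = -2 by norm_num] at h

/-- Key step in the paper's four-dimensional multiplicity proposition: for a
solution of `v'''' - 4v'' = 6e^{4v}` with `v(0) = v'(0) = 0`, `v'(t) → -1`,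
`v''(t) → 0`, `v'''(t) → 0`, one has `v''(0) = ±1`. -/
theorem stmt_11 (v : ℝ → ℝ) (hv : ContDiff ℝ (⊤ : ℕ∞) v)
    (heq : ∀ t ≥ (0 : ℝ),
      deriv^[4] v t - 4 * deriv^[2] v t = 6 * Real.exp (4 * v t))
    (h0 : v 0 = 0) (h1 : deriv v 0 = 0)
    (hlim1 : Tendsto (deriv v) atTop (nhds (-1)))
    (hlim2 : Tendsto (deriv^[2] v) atTop (nhds 0))
    (hlim3 : Tendsto (deriv^[3] v) atTop (nhds 0)) :
    deriv^[2] v 0 = 1 ∨ deriv^[2] v 0 = -1 := by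
  have hconst : Tendsto (firstIntegral v) atTop (nhds (firstIntegral v 0)) :=
    tendsto_const_nhds.congr' <| by
      filter_upwards [eventually_ge_atTop 0] with t ht
      exact (firstIntegral_eq_initial hv heq ht).symm
  have hE := tendsto_nhds_unique hconst
    (tendsto_firstIntegral (hv.differentiable (by simp)) hlim1 hlim2 hlim3)
  simp only [firstIntegral, h0, h1, mul_zero, exp_zero] at hE
  exact sq_eq_one_iff.1 (by linarith)
end
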